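/- arXiv:1604.07350 — 2 statements merged into one kernel-verified Lean document; each statement's English description precedes it below -/
import Mathlib

section
/- A probability measure μ on ℝ is infinitely divisible if and only if there exist b ∈ ℝ, σ ≥ 0 and a Lévy measure L on ℝ such that the characteristic function of μ satisfies φ(t) = exp( i b t − (1/2) σ² t² + ∫_ℝ (e^{itx} − 1 − i t sin x) dL(x) ) for all real t, the integral being absolutely convergent for every t. -/
open MeasureTheory Complex Filter

/-- The characteristic function of a measure on ℝ. -/
noncomputable def charFun' (μ : Measure ℝ) (t : ℝ) : ℂ :=
  ∫ x, Complex.exp (Complex.I * t * x) ∂μ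

/-- The `n`-fold convolution of a measure on ℝ, as the law of the sum of `n`
independent copies. -/
noncomputable def convPow (μ : Measure ℝ) (n : ℕ) : Measure ℝ :=
  Measure.map (fun x : Fin n → ℝ => ∑ i, x i) (Measure.pi fun _ => μ)

/-- A probability measure is infinitely divisible if for every `n ≥ 1` it is an
`n`-fold convolution power of some probability measure. -/
def IsInfinitelyDivisible (μ : Measure ℝ) : Prop :=
  ∀ n : ℕ, 0 < n → ∃ ν : Measure ℝ, IsProbabilityMeasure ν ∧ convPow ν n = μ

/-- `L` is a Lévy measure: no mass at `0` and `∫ min(x², 1) dL < ∞`. -/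
def IsLevyMeasure (L : Measure ℝ) : Prop :=
  L {0} = 0 ∧ ∫⁻ x, ENNReal.ofReal (min (x ^ 2) 1) ∂L < ⊤

open scoped Topology BoundedContinuousFunction

lemma charFun'_eq_charFun (μ : Measure ℝ) (t : ℝ) : charFun' μ t = charFun μ t := by
  rw [charFun', charFun_apply_real]
  congr with x
  ring_nf

instance isProbabilityMeasure_convPow (ν : Measure ℝ) [IsProbabilityMeasure ν] (n : ℕ) :
    IsProbabilityMeasure (convPow ν n) :=
  Measure.isProbabilityMeasure_map (by fun_prop)

lemma charFun_convPow (ν : Measure ℝ) [IsProbabilityMeasure ν] (n : ℕ) (t : ℝ) :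
    charFun (convPow ν n) t = charFun ν t ^ n := by
  rw [convPow, ProbabilityTheory.charFun_map_sum_pi_eq_prod]
  simp

/-- A pointwise limit of characteristic functions that is continuous at `0` is the characteristic
function of a probability measure. -/
lemma exists_charFun_eq_of_tendsto {μ : ℕ → ProbabilityMeasure ℝ} {f : ℝ → ℂ}
    (hf : ContinuousAt f 0) (h : ∀ t, Tendsto (fun n ↦ charFun (μ n) t) atTop (𝓝 (f t))) :
    ∃ μ₀ : ProbabilityMeasure ℝ, ∀ t, charFun (μ₀ : Measure ℝ) t = f t := by
  have h_tight : IsTightMeasureSet (Set.range fun n ↦ (μ n : Measure ℝ)) :=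
    isTightMeasureSet_of_tendsto_charFun hf h
  have h_compact : IsCompact (closure (Set.range μ)) :=
    isCompact_closure_of_isTightMeasureSet (by simpa [Set.range] using h_tight)
  let U : Ultrafilter ℕ := Ultrafilter.of atTop
  have hU : (U : Filter ℕ) ≤ atTop := Ultrafilter.of_le _
  obtain ⟨μ₀, -, hμ₀⟩ := h_compact.ultrafilter_le_nhds (U.map μ)
    (by
      refine le_principal_iff.mpr (mem_of_superset ?_ subset_closure)
      exact Ultrafilter.mem_map.mpr (univ_mem' fun n ↦ ⟨n, rfl⟩))
  refine ⟨μ₀, fun t ↦ tendsto_nhds_unique ?_ ((h t).mono_left hU)⟩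
  have hconv : Tendsto μ U (𝓝 μ₀) := hμ₀
  rw [ProbabilityMeasure.tendsto_iff_forall_integral_rclike_tendsto ℂ] at hconv
  simp_rw [charFun_eq_integral_innerProbChar]
  exact hconv _

/-- Lévy's continuity theorem for finite measures. -/
lemma exists_tendsto_integral_of_tendsto_charFun {G : ℕ → FiniteMeasure ℝ} {h : ℝ → ℂ}
    (hh : ContinuousAt h 0)
    (hG : ∀ t, Tendsto (fun n ↦ charFun (G n : Measure ℝ) t) atTop (𝓝 (h t))) :
    ∃ G₀ : FiniteMeasure ℝ, ∀ F : ℝ →ᵇ ℂ,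
      Tendsto (fun n ↦ ∫ x, F x ∂(G n : Measure ℝ)) atTop
        (𝓝 (∫ x, F x ∂(G₀ : Measure ℝ))) := by
  have h_integral (G : FiniteMeasure ℝ) (F : ℝ → ℂ) : ∫ x, F x ∂(G : Measure ℝ) =
      G.mass * ∫ x, F x ∂(G.normalize : Measure ℝ) := by
    conv_lhs => rw [G.self_eq_mass_smul_normalize]
    rw [FiniteMeasure.toMeasure_smul, integral_smul_nnreal_measure]
    rfl
  have hchar (G : FiniteMeasure ℝ) (t : ℝ) : charFun (G : Measure ℝ) t =
      G.mass * charFun (G.normalize : Measure ℝ) t := by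
    simp_rw [charFun_apply_real]
    exact h_integral G _
  have hmassC : Tendsto (fun n ↦ ((G n).mass : ℂ)) atTop (𝓝 (h 0)) := by
    refine (hG 0).congr fun n ↦ ?_
    rw [hchar, charFun_zero, probReal_univ, ofReal_one, mul_one]
  obtain ⟨m, hm⟩ : ∃ m : NNReal, h 0 = (m : ℂ) := by
    have hcl : IsClosed (Set.range fun m : NNReal ↦ ((m : ℝ) : ℂ)) :=
      (Complex.isometry_ofReal.isClosedEmbedding.comp NNReal.isClosedEmbedding_coe).isClosed_range
    obtain ⟨m, hm⟩ := hcl.mem_of_tendsto hmassC (.of_forall fun n ↦ ⟨_, rfl⟩)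
    exact ⟨m, hm.symm⟩
  rw [hm] at hmassC
  by_cases hm0 : m = 0
  · refine ⟨0, fun F ↦ ?_⟩
    simp only [FiniteMeasure.toMeasure_zero, integral_zero_measure]
    simp_rw [h_integral]
    refine squeeze_zero_norm (a := fun n ↦ ‖((G n).mass : ℂ)‖ * ‖F‖) (fun n ↦ ?_) ?_
    · rw [norm_mul]
      gcongr
      exact F.norm_integral_le_norm _
    · simpa [hm0] using (hmassC.norm.mul_const ‖F‖)
  · have hmC : (m : ℂ) ≠ 0 := by simpa using hm0
    have hlim (t : ℝ) : Tendsto (fun n ↦ charFun ((G n).normalize : Measure ℝ) t) atTop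
        (𝓝 (h t / m)) := by
      refine ((hG t).div hmassC hmC).congr' ?_
      filter_upwards [hmassC.eventually_ne hmC] with n hn
      rw [Pi.div_apply, hchar]
      field_simp
    obtain ⟨P, hP⟩ := exists_charFun_eq_of_tendsto (by fun_prop) hlim
    simp_rw [← hP] at hlim
    have hweak := ProbabilityMeasure.tendsto_of_tendsto_charFun hlim
    rw [ProbabilityMeasure.tendsto_iff_forall_integral_rclike_tendsto ℂ] at hweak
    refine ⟨m • P.toFiniteMeasure, fun F ↦ ?_⟩
    simp_rw [h_integral (G _)]
    rw [FiniteMeasure.toMeasure_smul, integral_smul_nnreal_measure]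
    exact hmassC.mul (hweak F)

/-- The Lévy–Khintchine integrand with truncation function `sin`. -/
noncomputable def levyKernel (t x : ℝ) : ℂ :=
  exp (I * t * x) - 1 - I * t * Real.sin x

@[fun_prop]
lemma continuous_levyKernel (t : ℝ) : Continuous (levyKernel t) := by
  unfold levyKernel
  fun_prop

lemma continuous_levyKernel_left (x : ℝ) : Continuous fun t ↦ levyKernel t x := by
  unfold levyKernel
  fun_prop

lemma norm_exp_I_mul_mul (t x : ℝ) : ‖exp (I * t * x)‖ = 1 := by
  rw [show I * t * x = (t * x : ℝ) * I by push_cast; ring, norm_exp_ofReal_mul_I]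

lemma norm_exp_I_mul_sub_one_sub_le (t x : ℝ) :
    ‖exp (I * t * x) - 1 - I * t * x‖ ≤ 3 * (t * x) ^ 2 := by
  have hn : ‖I * t * x‖ = |t * x| := by simp [abs_mul]
  rcases le_total |t * x| 1 with h | h
  · calc _ ≤ ‖I * t * x‖ ^ 2 := norm_exp_sub_one_sub_id_le (by rwa [hn])
      _ = (t * x) ^ 2 := by rw [hn, sq_abs]
      _ ≤ _ := by nlinarith [sq_nonneg (t * x)]
  · calc _ ≤ ‖exp (I * t * x)‖ + ‖(1 : ℂ)‖ + ‖I * t * x‖ :=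
          (norm_sub_le _ _).trans (by gcongr; exact norm_sub_le _ _)
      _ = 2 + |t * x| := by rw [norm_exp_I_mul_mul, hn, norm_one]; ring
      _ ≤ _ := by rw [← sq_abs]; nlinarith

lemma abs_sub_sin_le (x : ℝ) (hx : |x| ≤ 1) : |x - Real.sin x| ≤ |x| ^ 3 := by
  have h := Real.sin_bound hx
  have h0 := abs_nonneg x
  calc |x - Real.sin x| = |x ^ 3 / 6 - (Real.sin x - (x - x ^ 3 / 6))| := by ring_nf
    _ ≤ |x ^ 3 / 6| + |Real.sin x - (x - x ^ 3 / 6)| := abs_sub _ _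
    _ ≤ |x| ^ 3 / 6 + |x| ^ 5 / 100 := by
      gcongr
      rw [abs_div, abs_pow]; norm_num
    _ ≤ |x| ^ 3 := by
      have : |x| ^ 5 ≤ |x| ^ 3 := pow_le_pow_of_le_one h0 hx (by norm_num)
      have : 0 ≤ |x| ^ 3 := by positivity
      linarith

lemma norm_levyKernel_le (t x : ℝ) :
    ‖levyKernel t x‖ ≤ (3 * t ^ 2 + |t| + 2) * min (x ^ 2) 1 := by
  have ht := abs_nonneg t
  rcases le_total |x| 1 with hx | hx
  · have hx2 : x ^ 2 ≤ 1 := by rw [← sq_abs]; nlinarith [abs_nonneg x]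
    rw [min_eq_left hx2]
    calc ‖levyKernel t x‖
        = ‖(exp (I * t * x) - 1 - I * t * x) + I * t * (x - Real.sin x : ℝ)‖ := by
          rw [levyKernel]; push_cast; ring_nf
      _ ≤ 3 * (t * x) ^ 2 + |t| * |x| ^ 3 := by
          refine (norm_add_le _ _).trans (add_le_add (norm_exp_I_mul_sub_one_sub_le t x) ?_)
          rw [norm_mul, norm_mul, norm_I, one_mul, norm_real, norm_real, Real.norm_eq_abs,
            Real.norm_eq_abs]
          gcongr
          exact abs_sub_sin_le x hx
      _ ≤ _ := by
          have : |x| ^ 3 ≤ x ^ 2 := by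
            rw [← sq_abs]; exact pow_le_pow_of_le_one (abs_nonneg x) hx (by norm_num)
          nlinarith [sq_nonneg x, mul_le_mul_of_nonneg_left this ht]
  · have hx2 : 1 ≤ x ^ 2 := by rw [← sq_abs]; nlinarith
    rw [min_eq_right hx2, mul_one]
    calc ‖levyKernel t x‖ ≤ ‖exp (I * t * x)‖ + ‖(1 : ℂ)‖ + ‖I * t * Real.sin x‖ :=
          (norm_sub_le _ _).trans (by gcongr; exact norm_sub_le _ _)
      _ ≤ 1 + 1 + |t| * 1 := by
          rw [norm_exp_I_mul_mul, norm_one, norm_mul, norm_mul, norm_I, one_mul, norm_real,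
            norm_real, Real.norm_eq_abs, Real.norm_eq_abs]
          gcongr
          exact Real.abs_sin_le_one x
      _ ≤ _ := by nlinarith [sq_nonneg t]

lemma IsLevyMeasure.integrable_min {L : Measure ℝ} (hL : IsLevyMeasure L) :
    Integrable (fun x ↦ min (x ^ 2) 1) L := by
  refine ⟨by fun_prop, ?_⟩
  rw [hasFiniteIntegral_iff_ofReal (.of_forall fun x ↦ by positivity)]
  exact hL.2

lemma IsLevyMeasure.integrable_levyKernel {L : Measure ℝ} (hL : IsLevyMeasure L) (t : ℝ) :
    Integrable (levyKernel t) L :=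
  (hL.integrable_min.const_mul (3 * t ^ 2 + |t| + 2)).mono' (by fun_prop)
    (.of_forall fun x ↦ norm_levyKernel_le t x)

lemma IsLevyMeasure.continuous_integral_levyKernel {L : Measure ℝ} (hL : IsLevyMeasure L) :
    Continuous fun t ↦ ∫ x, levyKernel t x ∂L := by
  refine continuous_iff_continuousAt.mpr fun s ↦ ?_
  refine continuousAt_of_dominated
    (bound := fun x ↦ (3 * (|s| + 1) ^ 2 + (|s| + 1) + 2) * min (x ^ 2) 1)
    (.of_forall fun t ↦ by fun_prop) ?_ (hL.integrable_min.const_mul _)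
    (.of_forall fun x ↦ (continuous_levyKernel_left x).continuousAt)
  filter_upwards [Metric.ball_mem_nhds s one_pos] with t ht
  have hts : |t| ≤ |s| + 1 := by
    have := abs_sub_abs_le_abs_sub t s
    rw [Metric.mem_ball, Real.dist_eq] at ht
    linarith
  refine .of_forall fun x ↦ (norm_levyKernel_le t x).trans ?_
  have hsq : t ^ 2 ≤ (|s| + 1) ^ 2 := by
    rw [← sq_abs]
    gcongr
  gcongr

/-- Existence of compound Poisson distributions. -/
lemma exists_charFun_eq_compoundPoisson (L : Measure ℝ) [IsFiniteMeasure L] :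
    ∃ P : ProbabilityMeasure ℝ, ∀ t,
      charFun (P : Measure ℝ) t = exp (∫ x, (exp (I * t * x) - 1) ∂L) := by
  have hz (t : ℝ) : ∫ x, (exp (I * t * x) - 1) ∂L = charFun L t - L.real Set.univ := by
    rw [integral_sub, charFun_apply_real]
    · congr 1
      · congr with x; ring_nf
      · simp
    · exact (integrable_const (1 : ℝ)).mono' (by fun_prop)
        (.of_forall fun x ↦ (norm_exp_I_mul_mul t x).le)
    · fun_prop
  have hex (n : ℕ) : ∃ Q : ProbabilityMeasure ℝ, L.real Set.univ < n → ∀ t : ℝ,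
      charFun (Q : Measure ℝ) t = (1 + (∫ x, (exp (I * t * x) - 1) ∂L) / n) ^ n := by
    by_cases hn : L.real Set.univ < n
    swap
    · exact ⟨⟨Measure.dirac 0, inferInstance⟩, fun h ↦ absurd h hn⟩
    have hn0 : (0 : ℝ) < n := measureReal_nonneg.trans_lt hn
    let ν : Measure ℝ := (1 - L.real Set.univ / n).toNNReal • Measure.dirac 0 +
      (n : NNReal)⁻¹ • L
    have hc : 0 ≤ 1 - L.real Set.univ / n := by
      rw [sub_nonneg, div_le_one hn0]; exact hn.le
    have hν : IsProbabilityMeasure ν := by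
      rw [isProbabilityMeasure_iff_real]
      simp only [ν]
      rw [measureReal_add_apply, measureReal_nnreal_smul_apply, measureReal_nnreal_smul_apply]
      simp [hc]
      field_simp
      ring
    refine ⟨⟨convPow ν n, inferInstance⟩, fun _ t ↦ ?_⟩
    rw [ProbabilityMeasure.coe_mk, charFun_convPow, hz]
    congr 1
    have hi (M : Measure ℝ) [IsFiniteMeasure M] :
        Integrable (fun x : ℝ ↦ exp (t * x * I)) M :=
      (integrable_const (1 : ℝ)).mono' (by fun_prop) (.of_forall fun x ↦ by
        rw [← ofReal_mul, norm_exp_ofReal_mul_I])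
    rw [charFun_apply_real, integral_add_measure (hi _) (hi _), integral_smul_nnreal_measure,
      integral_smul_nnreal_measure, integral_dirac, ← charFun_apply_real]
    simp only [NNReal.smul_def, Real.coe_toNNReal _ hc, real_smul]
    push_cast
    simp
    ring
  choose Q hQ using hex
  refine exists_charFun_eq_of_tendsto (μ := Q) ?_ fun t ↦ ?_
  · simp_rw [hz]
    exact Continuous.continuousAt (by fun_prop)
  · refine (tendsto_one_add_div_pow_exp _).congr' ?_
    filter_upwards [tendsto_natCast_atTop_atTop.eventually_gt_atTop (L.real Set.univ)] with n hn
    rw [hQ n hn]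

lemma exists_charFun_eq_of_isFiniteMeasure (b σ : ℝ) (L : Measure ℝ) [IsFiniteMeasure L] :
    ∃ P : ProbabilityMeasure ℝ, ∀ t, charFun (P : Measure ℝ) t =
      exp (I * b * t - (σ ^ 2 * t ^ 2 : ℝ) / 2 + ∫ x, levyKernel t x ∂L) := by
  obtain ⟨P, hP⟩ := exists_charFun_eq_compoundPoisson L
  refine ⟨⟨P ∗ ProbabilityTheory.gaussianReal (b - ∫ x, Real.sin x ∂L)
    (σ ^ 2).toNNReal, inferInstance⟩, fun t ↦ ?_⟩
  have hexp : Integrable (fun x : ℝ ↦ exp (I * t * x) - 1) L :=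
    ((integrable_const (1 : ℝ)).mono' (by fun_prop)
      (.of_forall fun x ↦ (norm_exp_I_mul_mul t x).le)).sub (integrable_const 1)
  have hsin : Integrable (fun x : ℝ ↦ (Real.sin x : ℂ)) L :=
    (integrable_const (1 : ℝ)).mono' (by fun_prop) (.of_forall fun x ↦ by
      rw [norm_real]; exact Real.abs_sin_le_one x)
  have h_integral : ∫ x, levyKernel t x ∂L =
      ∫ x, (exp (I * t * x) - 1) ∂L - I * t * (∫ x, Real.sin x ∂L : ℝ) := by
    unfold levyKernel
    rw [integral_sub hexp (hsin.const_mul _), integral_const_mul, integral_complex_ofReal]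
  rw [ProbabilityMeasure.coe_mk, charFun_conv, hP, ProbabilityTheory.charFun_gaussianReal,
    ← Complex.exp_add, h_integral, Real.coe_toNNReal _ (sq_nonneg σ)]
  push_cast
  ring_nf

/-- Every Lévy triplet is the triplet of a probability measure. -/
lemma IsLevyMeasure.exists_charFun_eq {L : Measure ℝ} (hL : IsLevyMeasure L) (b σ : ℝ) :
    ∃ P : ProbabilityMeasure ℝ, ∀ t, charFun (P : Measure ℝ) t =
      exp (I * b * t - (σ ^ 2 * t ^ 2 : ℝ) / 2 + ∫ x, levyKernel t x ∂L) := by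
  let S (n : ℕ) : Set ℝ := {x | 1 / ((n : ℝ) + 1) < |x|}
  have hS (n : ℕ) : MeasurableSet (S n) := measurableSet_lt (by fun_prop) (by fun_prop)
  have hSmono : Monotone S := fun m n hmn ↦
    Set.ofPred_subset_ofPred.mpr fun x hx ↦ (Nat.one_div_le_one_div hmn).trans_lt hx
  have hSU : ⋃ n, S n = {0}ᶜ := by
    ext x
    simp only [Set.mem_iUnion, Set.mem_compl_iff, Set.mem_singleton_iff, S, Set.mem_ofPred_eq]
    refine ⟨fun ⟨n, hn⟩ h0 ↦ ?_, fun hx ↦ exists_nat_one_div_lt (abs_pos.mpr hx)⟩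
    rw [h0, abs_zero] at hn
    exact hn.not_ge (by positivity)
  have hfin (n : ℕ) : IsFiniteMeasure (L.restrict (S n)) := by
    refine ⟨?_⟩
    rw [Measure.restrict_apply_univ]
    have hε : 0 < min ((1 / ((n : ℝ) + 1)) ^ 2) 1 := by positivity
    refine (measure_mono (Set.ofPred_subset_ofPred.mpr fun x hx ↦ ?_)).trans_lt
      (hL.integrable_min.measure_ge_lt_top hε)
    rw [← sq_abs x]
    gcongr
  choose P hP using fun n ↦ exists_charFun_eq_of_isFiniteMeasure b σ (L.restrict (S n))
  refine exists_charFun_eq_of_tendsto (μ := P) ?_ fun t ↦ ?_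
  · have := hL.continuous_integral_levyKernel
    exact Continuous.continuousAt (by fun_prop)
  · simp_rw [hP]
    refine ((continuous_exp.tendsto _).comp (tendsto_const_nhds.add ?_))
    have := tendsto_setIntegral_of_monotone hS hSmono (f := levyKernel t) (μ := L)
      (hL.integrable_levyKernel t).integrableOn
    rwa [hSU, setIntegral_eq_integral_of_ae_compl_eq_zero] at this
    have h0 : ∀ᵐ x ∂L, x ≠ 0 := by simpa [ae_iff] using hL.1
    filter_upwards [h0] with x hx hx'
    exact absurd hx' (by simpa using hx)

lemma IsLevyMeasure.nnreal_smul {L : Measure ℝ} (hL : IsLevyMeasure L) (c : NNReal) :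
    IsLevyMeasure (c • L) := by
  refine ⟨by simp [hL.1], ?_⟩
  rw [lintegral_smul_measure]
  exact ENNReal.mul_lt_top ENNReal.coe_lt_top hL.2

lemma isInfinitelyDivisible_of_charFun_eq {μ : Measure ℝ} [IsProbabilityMeasure μ]
    {L : Measure ℝ} (hL : IsLevyMeasure L) (b σ : ℝ) (h : ∀ t, charFun μ t =
      exp (I * b * t - (σ ^ 2 * t ^ 2 : ℝ) / 2 + ∫ x, levyKernel t x ∂L)) :
    IsInfinitelyDivisible μ := by
  intro n hn
  obtain ⟨P, hP⟩ := (hL.nnreal_smul (n : NNReal)⁻¹).exists_charFun_eq (b / n) (σ / √n)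
  refine ⟨P, inferInstance, Measure.ext_of_charFun (funext fun t ↦ ?_)⟩
  have hn0 : (n : ℂ) ≠ 0 := by exact_mod_cast hn.ne'
  rw [charFun_convPow, hP, h, ← Complex.exp_nat_mul, integral_smul_nnreal_measure, div_pow,
    Real.sq_sqrt (Nat.cast_nonneg n)]
  simp only [NNReal.smul_def, real_smul]
  push_cast
  congr 1
  field_simp

/-- The weight `1 - sin x / x`, comparable to `min (x ^ 2) 1`. -/
noncomputable def sincWeight (x : ℝ) : ℝ := 1 - Real.sinc x

@[fun_prop]
lemma continuous_sincWeight : Continuous sincWeight :=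
  continuous_const.sub Real.continuous_sinc

lemma sincWeight_nonneg (x : ℝ) : 0 ≤ sincWeight x :=
  sub_nonneg.mpr (Real.sinc_le_one x)

lemma sincWeight_le_two (x : ℝ) : sincWeight x ≤ 2 := by
  have := Real.neg_one_le_sinc x
  rw [sincWeight]
  linarith

@[simp]
lemma sincWeight_zero : sincWeight 0 = 0 := by simp [sincWeight]

lemma min_sq_one_le_sincWeight (x : ℝ) : min (x ^ 2) 1 ≤ 50 * sincWeight x := by
  wlog hx : 0 ≤ x generalizing x
  · have := this (-x) (by linarith)
    rwa [neg_sq, sincWeight, Real.sinc_neg] at this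
  rcases hx.eq_or_lt with rfl | hx
  · simp
  rw [sincWeight, Real.sinc_of_ne_zero hx.ne']
  rcases le_total x 2 with h2 | h2
  · have hb := (abs_le.mp (Real.sin_bound (x := x / 2)
      (by rw [abs_of_pos (by linarith)]; linarith))).2
    rw [abs_of_pos (by linarith)] at hb
    have hs : 0 ≤ Real.sin (x / 2) :=
      Real.sin_nonneg_of_nonneg_of_le_pi (by linarith) (by linarith [Real.pi_gt_three])
    have hsin : Real.sin x ≤ 2 * Real.sin (x / 2) := by
      rw [show x = 2 * (x / 2) by ring, Real.sin_two_mul, ← show x = 2 * (x / 2) by ring]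
      nlinarith [Real.cos_le_one (x / 2)]
    have h5 : x ^ 5 ≤ 4 * x ^ 3 := by
      have : x ^ 2 ≤ 4 := by nlinarith
      have : 0 < x ^ 3 := by positivity
      nlinarith
    have hdiv : Real.sin x / x ≤ 1 - x ^ 2 / 50 := by
      rw [div_le_iff₀ hx]
      have : 0 < x ^ 3 := by positivity
      nlinarith
    refine (min_le_left _ _).trans ?_
    linarith
  · have : Real.sin x / x ≤ 1 / 2 :=
      div_le_div₀ zero_le_one (Real.sin_le_one x) two_pos h2
    refine (min_le_right _ _).trans ?_
    linarith

lemma sincWeight_pos {x : ℝ} (hx : x ≠ 0) : 0 < sincWeight x := by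
  have h := min_sq_one_le_sincWeight x
  have : 0 < min (x ^ 2) 1 := by positivity
  linarith

lemma tendsto_sincWeight_div_sq :
    Tendsto (fun x ↦ sincWeight x / x ^ 2) (𝓝[≠] 0) (𝓝 (1 / 6)) := by
  rw [tendsto_iff_norm_sub_tendsto_zero]
  have hlim : Tendsto (fun x : ℝ ↦ x ^ 2 / 100) (𝓝[≠] 0) (𝓝 0) := by
    have : Continuous fun x : ℝ ↦ x ^ 2 / 100 := by fun_prop
    simpa using (this.tendsto 0).mono_left nhdsWithin_le_nhds
  refine squeeze_zero' (.of_forall fun _ ↦ norm_nonneg _) ?_ hlim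
  filter_upwards [self_mem_nhdsWithin,
    nhdsWithin_le_nhds (Metric.closedBall_mem_nhds (0 : ℝ) one_pos)] with x hx hx1
  have hx0 : x ≠ 0 := hx
  have hx1 : |x| ≤ 1 := by simpa using hx1
  have hb := Real.sin_bound hx1
  have hpos : 0 < |x| := abs_pos.mpr hx0
  rw [sincWeight, Real.sinc_of_ne_zero hx0, Real.norm_eq_abs,
    show (1 - Real.sin x / x) / x ^ 2 - 1 / 6 = -(Real.sin x - (x - x ^ 3 / 6)) / x ^ 3 by
      field_simp; ring,
    abs_div, abs_neg, abs_pow, div_le_iff₀ (by positivity), ← sq_abs x]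
  calc _ ≤ _ := hb
    _ = _ := by ring

lemma tendsto_levyKernel_div_sq (t : ℝ) :
    Tendsto (fun x : ℝ ↦ levyKernel t x / (x ^ 2 : ℝ)) (𝓝[≠] 0) (𝓝 (-t ^ 2 / 2)) := by
  rw [tendsto_iff_norm_sub_tendsto_zero]
  have hlim : Tendsto (fun x : ℝ ↦ (|t| ^ 3 + |t|) * |x|) (𝓝[≠] 0) (𝓝 0) := by
    have : Continuous fun x : ℝ ↦ (|t| ^ 3 + |t|) * |x| := by fun_prop
    simpa using (this.tendsto 0).mono_left nhdsWithin_le_nhds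
  refine squeeze_zero' (.of_forall fun _ ↦ norm_nonneg _) ?_ hlim
  have hsmall : ∀ᶠ x : ℝ in 𝓝 0, |t * x| < 1 := by
    have : Continuous fun x : ℝ ↦ |t * x| := by fun_prop
    exact (this.tendsto 0).eventually_lt_const (by simp)
  filter_upwards [self_mem_nhdsWithin,
    nhdsWithin_le_nhds (Metric.closedBall_mem_nhds (0 : ℝ) one_pos),
    nhdsWithin_le_nhds hsmall] with x hx hx1 htx
  have hx0 : x ≠ 0 := hx
  have hx0' : (x : ℂ) ≠ 0 := by exact_mod_cast hx0
  have hx1 : |x| ≤ 1 := by simpa using hx1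
  have hpos : 0 < |x| := abs_pos.mpr hx0
  have hn : ‖I * t * x‖ = |t * x| := by simp [abs_mul]
  have hexp := Complex.exp_bound (x := I * t * x) (by rw [hn]; exact htx.le) (n := 3) (by norm_num)
  rw [hn] at hexp
  have hnum : ‖levyKernel t x + t ^ 2 * x ^ 2 / 2‖ ≤ (|t| ^ 3 + |t|) * |x| ^ 3 := by
    calc _ = ‖(exp (I * t * x) - ∑ m ∈ Finset.range 3, (I * t * x) ^ m / (m.factorial : ℂ)) +
          I * t * (x - Real.sin x : ℝ)‖ := by
          congr 1
          simp only [Finset.sum_range_succ, Finset.sum_range_zero, levyKernel, mul_pow, I_sq,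
            Nat.factorial]
          push_cast
          ring
      _ ≤ |t * x| ^ 3 + |t| * |x| ^ 3 := by
          refine (norm_add_le _ _).trans (add_le_add (hexp.trans ?_) ?_)
          · refine mul_le_of_le_one_right (by positivity) ?_
            norm_num [Nat.factorial]
          · rw [norm_mul, norm_mul, norm_I, one_mul, norm_real, norm_real, Real.norm_eq_abs,
              Real.norm_eq_abs]
            gcongr
            exact abs_sub_sin_le x hx1
      _ = _ := by rw [abs_mul]; ring
  rw [show levyKernel t x / (x ^ 2 : ℝ) - -(t : ℂ) ^ 2 / 2 =
      (levyKernel t x + t ^ 2 * x ^ 2 / 2) / (x ^ 2 : ℝ) by push_cast; field_simp; ring,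
    norm_div, norm_real, Real.norm_eq_abs, abs_pow, div_le_iff₀ (by positivity)]
  calc _ ≤ _ := hnum
    _ = _ := by ring

/-- The quotient of the Lévy–Khintchine integrand by `sincWeight`, extended by continuity to `0`. -/
noncomputable def levyQuotient (t x : ℝ) : ℂ :=
  if x = 0 then -3 * t ^ 2 else levyKernel t x / sincWeight x

lemma sincWeight_mul_levyQuotient (t x : ℝ) :
    (sincWeight x : ℂ) * levyQuotient t x = levyKernel t x := by
  by_cases hx : x = 0
  · simp [hx, levyKernel]
  · have : (sincWeight x : ℂ) ≠ 0 := by exact_mod_cast (sincWeight_pos hx).ne'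
    rw [levyQuotient, if_neg hx]
    field_simp

lemma continuous_levyQuotient (t : ℝ) : Continuous (levyQuotient t) := by
  refine continuous_iff_continuousAt.mpr fun x ↦ ?_
  by_cases hx : x = 0
  · subst hx
    rw [continuousAt_iff_punctured_nhds, levyQuotient, if_pos rfl]
    have h6 : Tendsto (fun x ↦ ((sincWeight x / x ^ 2 : ℝ) : ℂ)) (𝓝[≠] 0) (𝓝 ((1 / 6 : ℝ) : ℂ)) :=
      (continuous_ofReal.tendsto _).comp tendsto_sincWeight_div_sq
    have h := (tendsto_levyKernel_div_sq t).div h6 (by norm_num)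
    rw [show -(t : ℂ) ^ 2 / 2 / ((1 / 6 : ℝ) : ℂ) = -3 * t ^ 2 by push_cast; ring] at h
    refine h.congr' ?_
    filter_upwards [self_mem_nhdsWithin] with x hx
    have hx0 : x ≠ 0 := hx
    have hx0' : (x : ℂ) ≠ 0 := by exact_mod_cast hx0
    have : (sincWeight x : ℂ) ≠ 0 := by exact_mod_cast (sincWeight_pos hx0).ne'
    rw [levyQuotient, if_neg hx0, Pi.div_apply]
    push_cast
    field_simp
  · have hw : (sincWeight x : ℂ) ≠ 0 := by exact_mod_cast (sincWeight_pos hx).ne'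
    have h : ContinuousAt (fun x ↦ levyKernel t x / sincWeight x) x :=
      ContinuousAt.div (by fun_prop) (by fun_prop) hw
    refine h.congr ?_
    filter_upwards [isOpen_ne.mem_nhds hx] with y hy
    rw [levyQuotient, if_neg hy]

lemma norm_levyQuotient_le (t x : ℝ) :
    ‖levyQuotient t x‖ ≤ 50 * (3 * t ^ 2 + |t| + 2) := by
  by_cases hx : x = 0
  · rw [levyQuotient, if_pos hx]
    simp only [norm_mul, norm_neg, norm_pow, norm_real, Real.norm_eq_abs, sq_abs]
    norm_num
    nlinarith [sq_nonneg t, abs_nonneg t]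
  · have hw := sincWeight_pos hx
    rw [levyQuotient, if_neg hx, norm_div, norm_real, Real.norm_of_nonneg hw.le,
      div_le_iff₀ hw]
    refine (norm_levyKernel_le t x).trans ?_
    rw [mul_comm (50 : ℝ), mul_assoc]
    gcongr
    exact min_sq_one_le_sincWeight x

/-- `levyQuotient t` as a bounded continuous function. -/
noncomputable def levyQuotientBCF (t : ℝ) : ℝ →ᵇ ℂ :=
  .ofNormedAddCommGroup (levyQuotient t) (continuous_levyQuotient t) _ (norm_levyQuotient_le t)

@[simp]
lemma levyQuotientBCF_apply (t x : ℝ) : levyQuotientBCF t x = levyQuotient t x := rfl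

/-- A finite measure integrated against `levyQuotient` yields a Gaussian part and a
Lévy measure. -/
lemma exists_isLevyMeasure_integral_levyQuotient (G : Measure ℝ) [IsFiniteMeasure G] :
    ∃ (σ : ℝ) (L : Measure ℝ), 0 ≤ σ ∧ IsLevyMeasure L ∧ ∀ t,
      ∫ x, levyQuotient t x ∂G = -((σ ^ 2 * t ^ 2 : ℝ) : ℂ) / 2 + ∫ x, levyKernel t x ∂L := by
  let w (x : ℝ) : ENNReal := ENNReal.ofReal (sincWeight x)⁻¹
  have hw : Measurable w := by fun_prop
  have hG0 : ∀ᵐ x ∂G.restrict {0}ᶜ, x ≠ 0 := by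
    filter_upwards [ae_restrict_mem (measurableSet_singleton 0).compl] with x hx using hx
  refine ⟨√(6 * G.real {0}), (G.restrict {0}ᶜ).withDensity w, Real.sqrt_nonneg _, ⟨?_, ?_⟩,
    fun t ↦ ?_⟩
  · refine withDensity_absolutelyContinuous _ _ ?_
    simp
  · rw [lintegral_withDensity_eq_lintegral_mul _ hw (by fun_prop)]
    calc _ ≤ ∫⁻ _, 50 ∂G.restrict {0}ᶜ := by
          refine lintegral_mono_ae ?_
          filter_upwards [hG0] with x hx
          have hpos := sincWeight_pos hx
          rw [Pi.mul_apply, ← ENNReal.ofReal_mul (by positivity),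
            show (50 : ENNReal) = ENNReal.ofReal 50 by simp]
          refine ENNReal.ofReal_le_ofReal ?_
          rw [inv_mul_le_iff₀ hpos, mul_comm]
          exact min_sq_one_le_sincWeight x
      _ < ⊤ := by
          rw [lintegral_const]
          exact ENNReal.mul_lt_top (by simp) (measure_lt_top _ _)
  · have hi : Integrable (levyQuotient t) G := (levyQuotientBCF t).integrable G
    rw [← integral_add_compl (measurableSet_singleton 0) hi, integral_singleton,
      integral_withDensity_eq_integral_toReal_smul hw (.of_forall fun x ↦ ENNReal.ofReal_lt_top),
      Real.sq_sqrt (by positivity)]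
    congr 1
    · rw [levyQuotient, if_pos rfl, real_smul]
      push_cast
      ring
    · refine integral_congr_ae ?_
      filter_upwards [hG0] with x hx
      have hpos := sincWeight_pos hx
      rw [ENNReal.toReal_ofReal (by positivity), real_smul, levyQuotient, if_neg hx]
      push_cast
      field_simp

lemma IsInfinitelyDivisible.exists_charFun_pow_eq {μ : Measure ℝ} (h : IsInfinitelyDivisible μ) :
    ∃ ν : ℕ → ProbabilityMeasure ℝ, ∀ n t,
      charFun (ν n : Measure ℝ) t ^ (n + 1) = charFun μ t := by
  choose ν hν hνμ using fun n : ℕ ↦ h (n + 1) n.succ_pos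
  exact ⟨fun n ↦ ⟨ν n, hν n⟩, fun n t ↦ by
    rw [ProbabilityMeasure.coe_mk, ← charFun_convPow, hνμ]⟩

/-- The characteristic function of an infinitely divisible measure has no zero. -/
lemma IsInfinitelyDivisible.charFun_ne_zero {μ : Measure ℝ} [IsProbabilityMeasure μ]
    (h : IsInfinitelyDivisible μ) (t : ℝ) : charFun μ t ≠ 0 := by
  obtain ⟨ν, hν⟩ := h.exists_charFun_pow_eq
  let P (n : ℕ) : ProbabilityMeasure ℝ :=
    ⟨(ν n : Measure ℝ) ∗ (ν n : Measure ℝ).map (fun x ↦ -1 * x),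
      have := Measure.isProbabilityMeasure_map (μ := (ν n : Measure ℝ)) (f := fun x ↦ -1 * x)
        (by fun_prop)
      inferInstance⟩
  have hP (n : ℕ) (t : ℝ) :
      charFun (P n : Measure ℝ) t = (‖charFun (ν n : Measure ℝ) t‖ ^ 2 : ℝ) := by
    have := Measure.isProbabilityMeasure_map (μ := (ν n : Measure ℝ)) (f := fun x ↦ -1 * x)
      (by fun_prop)
    simp only [P, ProbabilityMeasure.coe_mk]
    rw [charFun_conv, charFun_map_mul, neg_one_mul, charFun_neg, mul_conj, normSq_eq_norm_sq]
  have hroot (n : ℕ) (t : ℝ) :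
      ‖charFun (ν n : Measure ℝ) t‖ = ‖charFun μ t‖ ^ (((n + 1 : ℕ) : ℝ)⁻¹) := by
    rw [← hν n t, norm_pow, Real.pow_rpow_inv_natCast (norm_nonneg _) n.succ_ne_zero]
  let f (t : ℝ) : ℂ := if charFun μ t = 0 then 0 else 1
  have hlim (t : ℝ) : Tendsto (fun n ↦ charFun (P n : Measure ℝ) t) atTop (𝓝 (f t)) := by
    simp_rw [hP, hroot]
    by_cases h0 : charFun μ t = 0
    · simp only [f, h0, if_true, norm_zero]
      refine tendsto_const_nhds.congr fun n ↦ ?_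
      rw [Real.zero_rpow (by positivity)]
      simp
    · simp only [f, h0, if_false]
      have hexp : Tendsto (fun n : ℕ ↦ ((n + 1 : ℕ) : ℝ)⁻¹) atTop (𝓝 0) :=
        tendsto_inv_atTop_zero.comp
          (tendsto_natCast_atTop_atTop.comp (tendsto_add_atTop_nat 1))
      have := ((Real.continuousAt_const_rpow (norm_ne_zero_iff.mpr h0)).tendsto.comp hexp).pow 2
      rw [Real.rpow_zero, one_pow] at this
      have hlim := (continuous_ofReal.tendsto _).comp this
      rw [ofReal_one] at hlim
      exact hlim
  have hf0 : ContinuousAt f 0 := by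
    have hne : ∀ᶠ t in 𝓝 0, charFun μ t ≠ 0 :=
      (continuous_charFun.tendsto (0 : ℝ)).eventually_ne (by simp)
    refine (continuousAt_const (y := (1 : ℂ))).congr ?_
    filter_upwards [hne] with t ht
    simp [f, ht]
  obtain ⟨P₀, hP₀⟩ := exists_charFun_eq_of_tendsto hf0 hlim
  have hfc : Continuous f := by
    rw [← funext hP₀]
    exact continuous_charFun
  have hZ : {t | charFun μ t = 0} = f ⁻¹' {1}ᶜ := by
    ext t
    by_cases h0 : charFun μ t = 0 <;> simp [f, h0]
  have hclopen : IsClopen {t | charFun μ t = 0} :=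
    ⟨isClosed_eq continuous_charFun continuous_const,
      hZ ▸ (isClosed_singleton.isOpen_compl).preimage hfc⟩
  rcases isClopen_iff.mp hclopen with hE | hE
  · exact fun h0 ↦ (Set.eq_empty_iff_forall_notMem.mp hE) t h0
  · have : (0 : ℝ) ∈ {t | charFun μ t = 0} := hE ▸ Set.mem_univ _
    simp at this

/-- Continuous logarithm of a continuous nonvanishing function on the line. -/
lemma exists_continuous_exp_eq {f : ℝ → ℂ} (hf : Continuous f) (hf0 : ∀ t, f t ≠ 0)
    (h1 : f 0 = 1) : ∃ ψ : ℝ → ℂ, Continuous ψ ∧ ψ 0 = 0 ∧ ∀ t, exp (ψ t) = f t := by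
  obtain ⟨ψ, ⟨h0, hψ⟩, -⟩ := isCoveringMapOn_exp.existsUnique_continuousMap_lifts
    (⟨f, hf⟩ : C(ℝ, ℂ)) (a₀ := (0 : ℝ)) (e₀ := 0) (by simp [h1]) (by simpa using hf0)
  exact ⟨ψ, ψ.continuous, h0, fun t ↦ congrFun hψ t⟩

/-- Two continuous `n`-th roots of the same function that agree at `0` are equal. -/
lemma eq_exp_div_of_pow_eq {f ψ : ℝ → ℂ} (hf : Continuous f) (hψ : Continuous ψ) (hf1 : f 0 = 1)
    (hψ0 : ψ 0 = 0) {n : ℕ} (hn : n ≠ 0) (h : ∀ t, f t ^ n = exp (ψ t)) (t : ℝ) :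
    f t = exp (ψ t / n) := by
  have hn' : (n : ℂ) ≠ 0 := by exact_mod_cast hn
  let r (t : ℝ) : ℂ := f t * exp (-(ψ t / n))
  have hr : Continuous r := by fun_prop
  have hroot (t : ℝ) : r t ^ n = 1 := by
    rw [mul_pow, h, ← Complex.exp_nat_mul, ← Complex.exp_add]
    have : ψ t + n * -(ψ t / n) = 0 := by field_simp; ring
    rw [this, Complex.exp_zero]
  have hfin : {z : ℂ | z ^ n = 1}.Finite := by
    refine (Polynomial.nthRootsFinset n (1 : ℂ)).finite_toSet.subset fun z hz ↦ ?_
    exact (Polynomial.mem_nthRootsFinset (Nat.pos_of_ne_zero hn) 1).mpr hz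
  have hconst : r t = r 0 := by
    have hsub : (Set.range r).Subsingleton :=
      hfin.countable.isTotallyDisconnected _ (Set.range_subset_iff.mpr hroot)
        (isPreconnected_range hr)
    exact hsub ⟨t, rfl⟩ ⟨0, rfl⟩
  have hr0 : r 0 = 1 := by simp [r, hf1, hψ0]
  rw [hr0] at hconst
  simp only [r, Complex.exp_neg] at hconst
  rwa [mul_inv_eq_one₀ (exp_ne_zero _)] at hconst

lemma norm_exp_sub_one_le_mul_exp (z : ℂ) : ‖exp z - 1‖ ≤ ‖z‖ * Real.exp ‖z‖ := by
  simpa using Complex.norm_exp_sub_sum_le_norm_mul_exp z 1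

lemma norm_natCast_mul_exp_div_sub_one_le (z : ℂ) {n : ℕ} (hn : n ≠ 0) :
    ‖n * (exp (z / n) - 1)‖ ≤ ‖z‖ * Real.exp ‖z‖ := by
  have hn' : (0 : ℝ) < n := by exact_mod_cast Nat.pos_of_ne_zero hn
  have hn1 : (1 : ℝ) ≤ n := by exact_mod_cast Nat.one_le_iff_ne_zero.mpr hn
  have hz : ‖z / n‖ = ‖z‖ / n := by simp
  rw [norm_mul, norm_natCast]
  calc _ ≤ n * (‖z / n‖ * Real.exp ‖z / n‖) := by
        gcongr; exact norm_exp_sub_one_le_mul_exp _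
    _ = ‖z‖ * Real.exp (‖z‖ / n) := by rw [hz]; field_simp
    _ ≤ _ := by gcongr; exact div_le_self (norm_nonneg _) hn1

lemma tendsto_natCast_mul_exp_div_sub_one (z : ℂ) :
    Tendsto (fun n : ℕ ↦ (n : ℂ) * (exp (z / n) - 1)) atTop (𝓝 z) := by
  have hd : HasDerivAt (fun w : ℂ ↦ exp (z * w)) z 0 := by
    simpa using ((hasDerivAt_id (0 : ℂ)).const_mul z).cexp
  have hinv : Tendsto (fun n : ℕ ↦ (n : ℂ)⁻¹) atTop (𝓝[≠] 0) := by
    refine tendsto_nhdsWithin_iff.mpr ⟨tendsto_inv_atTop_nhds_zero_nat, ?_⟩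
    filter_upwards [eventually_ne_atTop 0] with n hn
    simpa using hn
  refine ((hasDerivAt_iff_tendsto_slope.mp hd).comp hinv).congr fun n ↦ ?_
  simp [slope_def_field, div_eq_mul_inv, mul_comm]

/-- The Fourier transform of `sincWeight` times a probability measure. -/
lemma integral_exp_mul_sincWeight (ν : Measure ℝ) [IsProbabilityMeasure ν] (t : ℝ) :
    ∫ x, (sincWeight x : ℂ) * exp (t * x * I) ∂ν =
      2⁻¹ * ∫ s in (-1 : ℝ)..1, (charFun ν t - charFun ν (t + s)) := by
  have hnorm (a : ℝ) (x : ℝ) : ‖exp (a * x * I)‖ = 1 := by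
    rw [← ofReal_mul, norm_exp_ofReal_mul_I]
  have h_integral (a : ℝ) : Integrable (fun x : ℝ ↦ exp (a * x * I)) ν :=
    (integrable_const (1 : ℝ)).mono' (by fun_prop) (.of_forall fun x ↦ (hnorm a x).le)
  have hdiff (s : ℝ) : charFun ν t - charFun ν (t + s) =
      ∫ x : ℝ, (exp (t * x * I) - exp ((t + s : ℝ) * x * I)) ∂ν := by
    rw [charFun_apply_real, charFun_apply_real, integral_sub (h_integral _) (h_integral _)]
  simp_rw [hdiff]
  rw [intervalIntegral_integral_swap, ← integral_const_mul]
  · congr with x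
    have hfac (s : ℝ) : exp (t * x * I) - exp ((t + s : ℝ) * x * I) =
        exp (t * x * I) * (1 - exp (s * x * I)) := by
      rw [mul_sub, ← Complex.exp_add]
      push_cast
      ring_nf
    have hsinc : ∫ s in (-1 : ℝ)..1, exp (s * x * I) = 2 * Real.sinc x := by
      by_cases hx : x = 0
      · simp [hx]
        norm_num
      · have := intervalIntegral.integral_comp_mul_right (a := -1) (b := 1)
          (fun y : ℝ ↦ exp (y * I)) hx
        simp only [neg_mul, one_mul, ofReal_mul] at this
        rw [this, integral_exp_mul_I_eq_sinc, real_smul]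
        have hx' : (x : ℂ) ≠ 0 := by exact_mod_cast hx
        push_cast
        field_simp
    simp_rw [hfac]
    rw [intervalIntegral.integral_const_mul, intervalIntegral.integral_sub
      (by simp) (Continuous.intervalIntegrable (by fun_prop) _ _), hsinc]
    simp [sincWeight]
    ring
  · rw [Set.uIoc_of_le (by norm_num)]
    refine (integrable_const (2 : ℝ)).mono' (by fun_prop) (.of_forall fun p ↦ ?_)
    refine (norm_sub_le _ _).trans ?_
    rw [hnorm, hnorm]
    norm_num

lemma integral_levyKernel (ν : Measure ℝ) [IsProbabilityMeasure ν] (t : ℝ) :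
    ∫ x, levyKernel t x ∂ν = charFun ν t - 1 - I * t * (charFun ν 1).im := by
  have h_integral (a : ℝ) : Integrable (fun x : ℝ ↦ exp (a * x * I)) ν :=
    (integrable_const (1 : ℝ)).mono' (by fun_prop)
      (.of_forall fun x ↦ by rw [← ofReal_mul, norm_exp_ofReal_mul_I])
  have hsin_int : Integrable (fun x ↦ Real.sin x) ν :=
    (integrable_const (1 : ℝ)).mono' (by fun_prop) (.of_forall fun x ↦ Real.abs_sin_le_one x)
  have hsin : (charFun ν 1).im = ∫ x, Real.sin x ∂ν := by
    rw [charFun_apply_real, ← RCLike.im_eq_complex_im, ← integral_im (h_integral 1)]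
    refine integral_congr_ae (.of_forall fun x ↦ ?_)
    simp [exp_ofReal_mul_I_im]
  have hkernel (x : ℝ) :
      levyKernel t x = exp (t * x * I) - 1 - I * t * (Real.sin x : ℂ) := by
    rw [levyKernel, mul_rotate, mul_comm I]
  have hdiff : Integrable (fun x : ℝ ↦ exp (t * x * I) - 1) ν :=
    (h_integral t).sub (integrable_const 1)
  have hsin_int' : Integrable (fun x ↦ I * t * (Real.sin x : ℂ)) ν :=
    hsin_int.ofReal.const_mul _
  simp_rw [hkernel]
  rw [integral_sub hdiff hsin_int',
    integral_sub (h_integral t) (integrable_const 1), integral_const_mul, integral_complex_ofReal,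
    hsin, charFun_apply_real]
  simp

/-- The finite measure `c * (1 - sinc x) dν`. -/
noncomputable def sincWeighted (c : ℝ) (ν : ProbabilityMeasure ℝ) : FiniteMeasure ℝ :=
  ⟨(ν : Measure ℝ).withDensity fun x ↦ ENNReal.ofReal (c * sincWeight x),
    isFiniteMeasure_withDensity_ofReal <| Integrable.hasFiniteIntegral <|
      (((integrable_const (2 : ℝ)).mono' continuous_sincWeight.aestronglyMeasurable
        (.of_forall fun x ↦ by
          rw [Real.norm_of_nonneg (sincWeight_nonneg x)]
          exact sincWeight_le_two x)).const_mul c)⟩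

lemma integral_sincWeighted {c : ℝ} (hc : 0 ≤ c) (ν : ProbabilityMeasure ℝ) (F : ℝ → ℂ) :
    ∫ x, F x ∂(sincWeighted c ν : Measure ℝ) =
      c * ∫ x, (sincWeight x : ℂ) * F x ∂(ν : Measure ℝ) := by
  have hw : Measurable fun x ↦ ENNReal.ofReal (c * sincWeight x) :=
    (continuous_sincWeight.measurable.const_mul c).ennreal_ofReal
  change ∫ x, F x ∂(ν : Measure ℝ).withDensity (fun x ↦ ENNReal.ofReal (c * sincWeight x)) = _
  rw [integral_withDensity_eq_integral_toReal_smul hw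
    (.of_forall fun x ↦ ENNReal.ofReal_lt_top), ← integral_const_mul]
  refine integral_congr_ae (.of_forall fun x ↦ ?_)
  simp only [ENNReal.toReal_ofReal (mul_nonneg hc (sincWeight_nonneg x)), real_smul, ofReal_mul]
  ring

/-- The characteristic exponent of an infinitely divisible measure, up to a drift, is the
integral of `levyQuotient` against a finite measure. -/
lemma IsInfinitelyDivisible.exists_charFun_eq_exp_integral_levyQuotient {μ : Measure ℝ}
    [IsProbabilityMeasure μ] (h : IsInfinitelyDivisible μ) :
    ∃ (b : ℝ) (G : FiniteMeasure ℝ), ∀ t : ℝ,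
      charFun μ t = exp (I * b * t + ∫ x, levyQuotient t x ∂(G : Measure ℝ)) := by
  obtain ⟨ν, hν⟩ := h.exists_charFun_pow_eq
  obtain ⟨ψ, hψ, hψ0, hexp⟩ :=
    exists_continuous_exp_eq continuous_charFun h.charFun_ne_zero (by simp)
  let z (n : ℕ) (t : ℝ) : ℂ := ((n + 1 : ℕ) : ℂ) * (charFun (ν n : Measure ℝ) t - 1)
  have hz (n : ℕ) (t : ℝ) : z n t = ((n + 1 : ℕ) : ℂ) * (exp (ψ t / (n + 1 : ℕ)) - 1) := by
    simp only [z]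
    rw [eq_exp_div_of_pow_eq continuous_charFun hψ (by simp) hψ0 n.succ_ne_zero
      fun t ↦ (hν n t).trans (hexp t).symm]
  have hz_tendsto (t : ℝ) : Tendsto (fun n ↦ z n t) atTop (𝓝 (ψ t)) := by
    simp_rw [hz]
    exact (tendsto_natCast_mul_exp_div_sub_one (ψ t)).comp (tendsto_add_atTop_nat 1)
  have hz_bound (n : ℕ) (t : ℝ) : ‖z n t‖ ≤ ‖ψ t‖ * Real.exp ‖ψ t‖ := by
    rw [hz]
    exact norm_natCast_mul_exp_div_sub_one_le _ n.succ_ne_zero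
  have hz_cont (n : ℕ) : Continuous (z n) :=
    continuous_const.mul (continuous_charFun.sub continuous_const)
  have hG (t : ℝ) : Tendsto
      (fun n : ℕ ↦ charFun (sincWeighted (n + 1 : ℕ) (ν n) : Measure ℝ) t) atTop
      (𝓝 (2⁻¹ * ∫ s in (-1 : ℝ)..1, (ψ t - ψ (t + s)))) := by
    have hchar (n : ℕ) : charFun (sincWeighted (n + 1 : ℕ) (ν n) : Measure ℝ) t =
        2⁻¹ * ∫ s in (-1 : ℝ)..1, (z n t - z n (t + s)) := by
      rw [charFun_apply_real, integral_sincWeighted (Nat.cast_nonneg _),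
        integral_exp_mul_sincWeight, mul_left_comm, ← intervalIntegral.integral_const_mul]
      congr 2 with s
      simp only [z, ofReal_natCast]
      ring
    simp_rw [hchar]
    refine Tendsto.const_mul _ ?_
    refine intervalIntegral.tendsto_integral_filter_of_dominated_convergence
      (fun s ↦ ‖ψ t‖ * Real.exp ‖ψ t‖ + ‖ψ (t + s)‖ * Real.exp ‖ψ (t + s)‖)
      (.of_forall fun n ↦ ?_) (.of_forall fun n ↦ .of_forall fun s _ ↦ ?_) ?_
      (.of_forall fun s _ ↦ (hz_tendsto t).sub (hz_tendsto (t + s)))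
    · have := hz_cont n
      exact Continuous.aestronglyMeasurable (by fun_prop)
    · exact (norm_sub_le _ _).trans (add_le_add (hz_bound n t) (hz_bound n (t + s)))
    · exact Continuous.intervalIntegrable (by fun_prop) _ _
  have hcont : Continuous fun t ↦ 2⁻¹ * ∫ s in (-1 : ℝ)..1, (ψ t - ψ (t + s)) :=
    continuous_const.mul <|
      intervalIntegral.continuous_parametric_intervalIntegral_of_continuous'
        (f := fun t s ↦ ψ t - ψ (t + s)) (by simp only [Function.uncurry_def]; fun_prop) _ _
  obtain ⟨G₀, hG₀⟩ := exists_tendsto_integral_of_tendsto_charFun hcont.continuousAt hG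
  refine ⟨(ψ 1).im, G₀, fun t ↦ ?_⟩
  have hlim : Tendsto (fun n ↦ z n t - I * t * (z n 1).im) atTop
      (𝓝 (ψ t - I * t * (ψ 1).im)) :=
    (hz_tendsto t).sub <| ((continuous_ofReal.comp continuous_im).tendsto _ |>.comp
      (hz_tendsto 1)).const_mul _
  have hquot (n : ℕ) : ∫ x, levyQuotientBCF t x ∂(sincWeighted (n + 1 : ℕ) (ν n) : Measure ℝ) =
      z n t - I * t * (z n 1).im := by
    simp_rw [levyQuotientBCF_apply]
    rw [integral_sincWeighted (Nat.cast_nonneg _)]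
    simp_rw [sincWeight_mul_levyQuotient]
    rw [integral_levyKernel]
    have him : (z n 1).im = ((n + 1 : ℕ) : ℝ) * (charFun (ν n : Measure ℝ) 1).im := by
      simp only [z, ← ofReal_natCast, im_ofReal_mul, sub_im, one_im, sub_zero]
    rw [him]
    simp only [z, ofReal_natCast, ofReal_mul]
    ring
  have heq := tendsto_nhds_unique ((hG₀ (levyQuotientBCF t)).congr hquot) hlim
  simp_rw [levyQuotientBCF_apply] at heq
  rw [heq, ← hexp t]
  ring_nf

theorem stmt1 (μ : Measure ℝ) [IsProbabilityMeasure μ] :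
    IsInfinitelyDivisible μ ↔
      ∃ (b σ : ℝ) (L : Measure ℝ), 0 ≤ σ ∧ IsLevyMeasure L ∧
        (∀ t : ℝ, Integrable
          (fun x : ℝ => Complex.exp (Complex.I * t * x) - 1 - Complex.I * t * Real.sin x) L) ∧
        ∀ t : ℝ, charFun' μ t =
          Complex.exp (Complex.I * b * t - (σ ^ 2 * t ^ 2 : ℝ) / 2 +
            ∫ x : ℝ, (Complex.exp (Complex.I * t * x) - 1 - Complex.I * t * Real.sin x) ∂L) := by
  constructor
  · intro h
    obtain ⟨b, G, hG⟩ := h.exists_charFun_eq_exp_integral_levyQuotient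
    obtain ⟨σ, L, hσ, hL, hLG⟩ := exists_isLevyMeasure_integral_levyQuotient (G : Measure ℝ)
    refine ⟨b, σ, L, hσ, hL, hL.integrable_levyKernel, fun t ↦ ?_⟩
    rw [charFun'_eq_charFun, hG, hLG]
    simp only [levyKernel]
    ring_nf
  · rintro ⟨b, σ, L, -, hL, -, h⟩
    exact isInfinitelyDivisible_of_charFun_eq hL b σ fun t ↦ by
      rw [← charFun'_eq_charFun]
      exact h t
end

section
/- For every real κ > 0 that is not an odd integer, and every real θ ≠ 0, the improper integral lim_{T→∞} ∫₀^T x^{−κ} ( cos(θx) − Σ_{0 ≤ j < (κ−1)/2} (−1)^j (θx)^{2j}/(2j)! ) dx exists and equals C(κ)·|θ|^{κ−1}, where C(κ) = (π/2)/(Γ(κ) cos(πκ/2)); moreover, when κ is not an integer, C(κ) = Γ(1−κ) sin(πκ/2). -/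
open MeasureTheory Filter Real

/-- The remainder of the Maclaurin series of `cos` after its first `N` nonzero terms. -/
noncomputable def cosRemainder (N : ℕ) (x : ℝ) : ℝ :=
  cos x - ∑ j ∈ Finset.range N, (-1 : ℝ) ^ j * x ^ (2 * j) / (Nat.factorial (2 * j) : ℝ)

/-- The remainder of the Maclaurin series of `sin` after its first `N` nonzero terms. -/
noncomputable def sinRemainder (N : ℕ) (x : ℝ) : ℝ :=
  sin x - ∑ j ∈ Finset.range N, (-1 : ℝ) ^ j * x ^ (2 * j + 1) / (Nat.factorial (2 * j + 1) : ℝ)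

lemma cosRemainder_succ (N : ℕ) (x : ℝ) :
    cosRemainder (N + 1) x =
      cosRemainder N x - (-1 : ℝ) ^ N * x ^ (2 * N) / (Nat.factorial (2 * N) : ℝ) := by
  simp only [cosRemainder, Finset.sum_range_succ]
  ring

lemma sinRemainder_succ (N : ℕ) (x : ℝ) :
    sinRemainder (N + 1) x =
      sinRemainder N x - (-1 : ℝ) ^ N * x ^ (2 * N + 1) / (Nat.factorial (2 * N + 1) : ℝ) := by
  simp only [sinRemainder, Finset.sum_range_succ]
  ring

lemma hasDerivAt_pow_succ_div_factorial (n : ℕ) (x : ℝ) :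
    HasDerivAt (fun y : ℝ => y ^ (n + 1) / (Nat.factorial (n + 1) : ℝ))
      (x ^ n / (Nat.factorial n : ℝ)) x := by
  convert! (hasDerivAt_pow (n + 1) x).div_const (Nat.factorial (n + 1) : ℝ) using 1
  rw [Nat.factorial_succ]
  push_cast
  have : (Nat.factorial n : ℝ) ≠ 0 := by positivity
  have : (n + 1 : ℝ) ≠ 0 := by positivity
  field_simp

lemma hasDerivAt_sinRemainder (N : ℕ) (x : ℝ) :
    HasDerivAt (sinRemainder N) (cosRemainder N x) x := by
  induction N with
  | zero =>
    have h0 : sinRemainder 0 = sin := by ext y; simp [sinRemainder]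
    simpa [h0, cosRemainder] using hasDerivAt_sin x
  | succ N ih =>
    rw [funext (sinRemainder_succ N), cosRemainder_succ]
    simp only [mul_div_assoc]
    exact ih.sub ((hasDerivAt_pow_succ_div_factorial (2 * N) x).const_mul _)

lemma hasDerivAt_cosRemainder_succ (N : ℕ) (x : ℝ) :
    HasDerivAt (cosRemainder (N + 1)) (-sinRemainder N x) x := by
  induction N with
  | zero =>
    have h0 : cosRemainder 1 = fun y => cos y - 1 := by ext y; simp [cosRemainder]
    simpa [h0, sinRemainder] using (hasDerivAt_cos x).sub_const 1
  | succ N ih =>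
    rw [funext (cosRemainder_succ (N + 1)), sinRemainder_succ]
    simp only [mul_div_assoc]
    convert! ih.sub ((hasDerivAt_pow_succ_div_factorial (2 * N + 1) x).const_mul
      ((-1 : ℝ) ^ (N + 1))) using 1
    ring

lemma cosRemainder_succ_zero (N : ℕ) : cosRemainder (N + 1) 0 = 0 := by
  simp [cosRemainder, Finset.sum_range_succ']

lemma sinRemainder_zero (N : ℕ) : sinRemainder N 0 = 0 := by
  simp [sinRemainder]

lemma continuous_cosRemainder (N : ℕ) : Continuous (cosRemainder N) := by
  unfold cosRemainder
  fun_prop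

/-- A function vanishing at `0` with nonnegative derivative on `[0, ∞)` is nonnegative there. -/
lemma nonneg_of_hasDerivAt_nonneg {f f' : ℝ → ℝ} (hf : ∀ x, HasDerivAt f (f' x) x)
    (h0 : f 0 = 0) (hf' : ∀ x, 0 ≤ x → 0 ≤ f' x) {x : ℝ} (hx : 0 ≤ x) : 0 ≤ f x := by
  have hmono : MonotoneOn f (Set.Ici 0) := by
    refine monotoneOn_of_deriv_nonneg (convex_Ici 0)
      (fun y _ => (hf y).continuousAt.continuousWithinAt)
      (fun y _ => (hf y).differentiableAt.differentiableWithinAt) fun y hy => ?_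
    rw [interior_Ici, Set.mem_Ioi] at hy
    rw [(hf y).deriv]
    exact hf' y hy.le
  simpa [h0] using hmono Set.self_mem_Ici hx hx

lemma neg_one_pow_mul_cosRemainder_succ_nonneg (N : ℕ) {x : ℝ} (hx : 0 ≤ x) :
    0 ≤ (-1 : ℝ) ^ (N + 1) * cosRemainder (N + 1) x := by
  induction N generalizing x with
  | zero => simpa [cosRemainder] using cos_le_one x
  | succ N ih =>
    refine nonneg_of_hasDerivAt_nonneg
      (f := fun y => (-1 : ℝ) ^ (N + 1 + 1) * cosRemainder (N + 1 + 1) y)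
      (f' := fun y => (-1 : ℝ) ^ (N + 1) * sinRemainder (N + 1) y) (fun y => ?_)
      (by simp [cosRemainder_succ_zero]) (fun y hy => ?_) hx
    · convert! (hasDerivAt_cosRemainder_succ (N + 1) y).const_mul ((-1 : ℝ) ^ (N + 1 + 1)) using 1
      ring
    · exact nonneg_of_hasDerivAt_nonneg
        (f := fun z => (-1 : ℝ) ^ (N + 1) * sinRemainder (N + 1) z)
        (fun z => (hasDerivAt_sinRemainder (N + 1) z).const_mul _)
        (by simp [sinRemainder_zero]) (fun z hz => ih hz) hy

lemma abs_cosRemainder_succ (N : ℕ) {x : ℝ} (hx : 0 ≤ x) :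
    |cosRemainder (N + 1) x| = (-1 : ℝ) ^ (N + 1) * cosRemainder (N + 1) x := by
  rw [← abs_of_nonneg (neg_one_pow_mul_cosRemainder_succ_nonneg N hx), abs_mul, abs_pow]
  simp

/-- The Laplace transform of `cos`. -/
lemma integral_exp_neg_mul_cos {t : ℝ} (ht : 0 < t) :
    IntegrableOn (fun x => exp (-(t * x)) * cos x) (Set.Ioi 0) ∧
      ∫ x in Set.Ioi 0, exp (-(t * x)) * cos x = t / (1 + t ^ 2) := by
  have hre : ∀ x : ℝ, exp (-(t * x)) * cos x =
      RCLike.re (Complex.exp ((-t + Complex.I) * x)) := fun x => by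
    simp [Complex.exp_re]
  have ha : (-(t : ℂ) + Complex.I).re < 0 := by simpa using ht
  have hint := integrableOn_exp_mul_complex_Ioi ha 0
  simp only [hre]
  refine ⟨hint.re, ?_⟩
  have h := integral_re hint
  rw [h, integral_exp_mul_complex_Ioi ha]
  simp [Complex.div_re, Complex.normSq_apply]
  field_simp
  ring

lemma integral_exp_neg_mul_pow (n : ℕ) {t : ℝ} (ht : 0 < t) :
    IntegrableOn (fun x => exp (-(t * x)) * x ^ n) (Set.Ioi 0) ∧
      ∫ x in Set.Ioi 0, exp (-(t * x)) * x ^ n = (Nat.factorial n : ℝ) / t ^ (n + 1) := by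
  have hn : (-1 : ℝ) < n := by linarith [(Nat.cast_nonneg n : (0 : ℝ) ≤ n)]
  have hint := integrableOn_rpow_mul_exp_neg_mul_rpow (p := 1) hn one_pos ht
  have hval := integral_rpow_mul_exp_neg_mul_Ioi (a := (n : ℝ) + 1) (by positivity) ht
  simp only [rpow_one, rpow_natCast, add_sub_cancel_right, neg_mul, mul_comm (_ ^ n)] at hint hval
  refine ⟨hint, ?_⟩
  rw [hval, Gamma_nat_eq_factorial, ← Nat.cast_succ, rpow_natCast, one_div_pow, Nat.succ_eq_add_one]
  field_simp

/-- The Laplace transform of the remainder of the Maclaurin series of `cos`. -/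
lemma integral_exp_neg_mul_cosRemainder (N : ℕ) {t : ℝ} (ht : 0 < t) :
    IntegrableOn (fun x => exp (-(t * x)) * cosRemainder N x) (Set.Ioi 0) ∧
      ∫ x in Set.Ioi 0, exp (-(t * x)) * cosRemainder N x =
        (-1 : ℝ) ^ N * (t / (t ^ (2 * N) * (1 + t ^ 2))) := by
  induction N with
  | zero => simpa [cosRemainder] using integral_exp_neg_mul_cos ht
  | succ N ih =>
    obtain ⟨hi, hv⟩ := integral_exp_neg_mul_pow (2 * N) ht
    have hi' := hi.const_mul ((-1 : ℝ) ^ N / (Nat.factorial (2 * N) : ℝ))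
    have heq : (fun x => exp (-(t * x)) * cosRemainder (N + 1) x) = fun x =>
        exp (-(t * x)) * cosRemainder N x -
          (-1 : ℝ) ^ N / (Nat.factorial (2 * N) : ℝ) * (exp (-(t * x)) * x ^ (2 * N)) := by
      ext x
      rw [cosRemainder_succ]
      ring
    rw [heq]
    refine ⟨ih.1.sub hi', ?_⟩
    rw [integral_sub ih.1 hi', ih.2, integral_const_mul, hv]
    have : (Nat.factorial (2 * N) : ℝ) ≠ 0 := by positivity
    field_simp
    ring

/-- The Mellin transform of `t ↦ 1 / (1 + t ^ 2)`. -/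
lemma integral_rpow_div_one_add_sq {s : ℝ} (hs : -1 < s) (hs' : s < 1) :
    IntegrableOn (fun t : ℝ => t ^ s / (1 + t ^ 2)) (Set.Ioi 0) ∧
      ∫ t in Set.Ioi (0 : ℝ), t ^ s / (1 + t ^ 2) = π / 2 / cos (π * s / 2) := by
  have hinner : ∀ t : ℝ,
      ∫ u in Set.Ioi (0 : ℝ), t ^ s * exp (-((1 + t ^ 2) * u)) = t ^ s / (1 + t ^ 2) := by
    intro t
    have := integral_exp_mul_Ioi (a := -(1 + t ^ 2)) (by nlinarith [sq_nonneg t]) 0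
    simp only [neg_mul] at this
    rw [integral_const_mul, this, neg_div_neg_eq]
    simp [div_eq_mul_inv]
  have houter : ∀ u ∈ Set.Ioi (0 : ℝ),
      ∫ t in Set.Ioi (0 : ℝ), t ^ s * exp (-((1 + t ^ 2) * u)) =
        1 / 2 * Gamma ((s + 1) / 2) * (exp (-u) * u ^ ((1 - s) / 2 - 1)) := by
    intro u hu
    have h := integral_rpow_mul_exp_neg_mul_rpow (p := 2) two_pos hs hu
    simp only [rpow_two] at h
    calc _ = ∫ t in Set.Ioi (0 : ℝ), exp (-u) * (t ^ s * exp (-u * t ^ 2)) := by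
          congr 1 with t
          rw [mul_left_comm, ← exp_add]
          ring_nf
      _ = _ := by
          rw [integral_const_mul, h, show -(s + 1) / 2 = (1 - s) / 2 - 1 by ring]
          ring
  have hGamma := GammaIntegral_convergent (s := (1 - s) / 2) (by linarith)
  have hprod : Integrable (Function.uncurry fun u t : ℝ => t ^ s * exp (-((1 + t ^ 2) * u)))
      ((volume.restrict (Set.Ioi 0)).prod (volume.restrict (Set.Ioi 0))) := by
    rw [integrable_prod_iff (by
      apply Measurable.aestronglyMeasurable
      unfold Function.uncurry
      fun_prop)]
    constructor
    · filter_upwards [ae_restrict_mem measurableSet_Ioi] with u hu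
      have h := (integrableOn_rpow_mul_exp_neg_mul_sq hu hs).const_mul (exp (-u))
      refine h.congr (ae_of_all _ fun t => ?_)
      simp only [Function.uncurry]
      rw [mul_left_comm, ← exp_add]
      ring_nf
    · refine (hGamma.const_mul (1 / 2 * Gamma ((s + 1) / 2))).congr ?_
      filter_upwards [ae_restrict_mem measurableSet_Ioi] with u hu
      rw [← houter u hu]
      refine setIntegral_congr_fun measurableSet_Ioi fun t ht => ?_
      have : (0 : ℝ) ≤ t ^ s := rpow_nonneg (le_of_lt ht) _
      simp [Function.uncurry, abs_of_nonneg this]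
  constructor
  · simpa only [IntegrableOn, Function.uncurry, hinner] using hprod.integral_prod_right
  · have hswap := integral_integral_swap hprod
    simp only [hinner] at hswap
    rw [← hswap, setIntegral_congr_fun measurableSet_Ioi houter, integral_const_mul,
      ← Gamma_eq_integral (by linarith)]
    have h := Gamma_mul_Gamma_one_sub ((s + 1) / 2)
    rw [show 1 - (s + 1) / 2 = (1 - s) / 2 by ring,
      show π * ((s + 1) / 2) = π * s / 2 + π / 2 by ring, sin_add_pi_div_two] at h
    rw [mul_assoc, h]
    ring

lemma integral_Ioi_rpow_mul_exp_neg_mul {κ : ℝ} (hκ : 0 < κ) {x : ℝ} (hx : 0 < x) :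
    ∫ t in Set.Ioi (0 : ℝ), t ^ (κ - 1) * exp (-(t * x)) = Gamma κ * x ^ (-κ) := by
  have h := integral_rpow_mul_exp_neg_mul_Ioi hκ hx
  simp only [mul_comm x] at h
  rw [h, one_div, inv_rpow hx.le, rpow_neg hx.le, mul_comm]

lemma integrableOn_rpow_mul_exp_neg_mul {κ : ℝ} (hκ : 0 < κ) {x : ℝ} (hx : 0 < x) :
    IntegrableOn (fun t : ℝ => t ^ (κ - 1) * exp (-(t * x))) (Set.Ioi 0) := by
  have h := integrableOn_rpow_mul_exp_neg_mul_rpow (p := 1) (s := κ - 1) (by linarith) one_pos hx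
  simpa only [rpow_one, neg_mul, mul_comm x] using h

/-- The integral of `x ^ (-κ)` against the remainder of the Maclaurin series of `cos` after
`N + 1` terms, in the range of `κ` where it converges absolutely. -/
lemma integral_rpow_neg_mul_cosRemainder_succ {κ : ℝ} (N : ℕ) (hκ : 2 * (N : ℝ) + 1 < κ)
    (hκ' : κ < 2 * (N : ℝ) + 3) :
    IntegrableOn (fun x : ℝ => x ^ (-κ) * cosRemainder (N + 1) x) (Set.Ioi 0) ∧
      ∫ x in Set.Ioi (0 : ℝ), x ^ (-κ) * cosRemainder (N + 1) x =
        π / 2 / (Gamma κ * cos (π * κ / 2)) := by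
  have hκ0 : 0 < κ := by linarith [(Nat.cast_nonneg N : (0 : ℝ) ≤ N)]
  have hΓ : Gamma κ ≠ 0 := (Gamma_pos_of_pos hκ0).ne'
  set s : ℝ := κ - 2 * ((N + 1 : ℕ) : ℝ) with hs
  obtain ⟨hMi, hMv⟩ := integral_rpow_div_one_add_sq (s := s)
    (by rw [hs]; push_cast; linarith) (by rw [hs]; push_cast; linarith)
  have hpow : ∀ t ∈ Set.Ioi (0 : ℝ),
      t ^ (κ - 1) * (t / (t ^ (2 * (N + 1)) * (1 + t ^ 2))) = t ^ s / (1 + t ^ 2) := by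
    intro t ht
    have ht : 0 < t := ht
    have h2 : t ^ s = t ^ κ / t ^ (2 * (N + 1)) := by
      rw [hs, rpow_sub ht, ← rpow_natCast t (2 * (N + 1))]
      push_cast
      rfl
    rw [h2, rpow_sub_one ht.ne']
    field_simp
  have hx : ∀ x ∈ Set.Ioi (0 : ℝ),
      ∫ t in Set.Ioi (0 : ℝ), t ^ (κ - 1) * exp (-(t * x)) * cosRemainder (N + 1) x =
        Gamma κ * (x ^ (-κ) * cosRemainder (N + 1) x) := by
    intro x hx
    rw [integral_mul_const, integral_Ioi_rpow_mul_exp_neg_mul hκ0 hx, mul_assoc]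
  have ht : ∀ t ∈ Set.Ioi (0 : ℝ),
      ∫ x in Set.Ioi (0 : ℝ), t ^ (κ - 1) * exp (-(t * x)) * cosRemainder (N + 1) x =
        (-1 : ℝ) ^ (N + 1) * (t ^ s / (1 + t ^ 2)) := by
    intro t ht
    simp only [mul_assoc]
    rw [integral_const_mul, (integral_exp_neg_mul_cosRemainder (N + 1) ht).2, ← hpow t ht]
    ring
  have hprod : Integrable (Function.uncurry fun x t : ℝ =>
      t ^ (κ - 1) * exp (-(t * x)) * cosRemainder (N + 1) x)
      ((volume.restrict (Set.Ioi 0)).prod (volume.restrict (Set.Ioi 0))) := by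
    have hmeas := (continuous_cosRemainder (N + 1)).measurable
    rw [integrable_prod_iff' (by
      apply Measurable.aestronglyMeasurable
      unfold Function.uncurry
      fun_prop)]
    constructor
    · filter_upwards [ae_restrict_mem measurableSet_Ioi] with t ht
      simpa only [Function.uncurry, mul_assoc] using
        (integral_exp_neg_mul_cosRemainder (N + 1) ht).1.const_mul (t ^ (κ - 1))
    · refine hMi.congr ?_
      filter_upwards [ae_restrict_mem measurableSet_Ioi] with t ht'
      have hsq : ((-1 : ℝ) ^ (N + 1)) * (-1 : ℝ) ^ (N + 1) = 1 := by
        rw [← mul_pow]; simp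
      calc t ^ s / (1 + t ^ 2)
          = (-1 : ℝ) ^ (N + 1) * ∫ x in Set.Ioi (0 : ℝ),
              t ^ (κ - 1) * exp (-(t * x)) * cosRemainder (N + 1) x := by
            rw [ht t ht', ← mul_assoc, hsq, one_mul]
        _ = _ := by
            rw [← integral_const_mul]
            refine setIntegral_congr_fun measurableSet_Ioi fun x hx' => ?_
            have h0 : (0 : ℝ) ≤ t ^ (κ - 1) := rpow_nonneg (le_of_lt ht') _
            simp only [Function.uncurry, norm_mul, norm_eq_abs, abs_of_nonneg h0, abs_exp,
              abs_cosRemainder_succ N (le_of_lt hx')]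
            ring
  constructor
  · refine (hprod.integral_prod_left.const_mul (Gamma κ)⁻¹).congr ?_
    filter_upwards [ae_restrict_mem measurableSet_Ioi] with x hx'
    simp only [Function.uncurry]
    rw [hx x hx', inv_mul_cancel_left₀ hΓ]
  · have hswap := integral_integral_swap hprod
    rw [setIntegral_congr_fun measurableSet_Ioi hx, setIntegral_congr_fun measurableSet_Ioi ht,
      integral_const_mul, integral_const_mul, hMv, hs,
      show π * (κ - 2 * ((N + 1 : ℕ) : ℝ)) / 2 = π * κ / 2 - ((N + 1 : ℕ) : ℝ) * π by ring,
      cos_sub_nat_mul_pi] at hswap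
    rw [← mul_right_inj' hΓ, hswap]
    have hsgn : ((-1 : ℝ) ^ (N + 1)) ≠ 0 := by simp
    rw [mul_div_assoc', mul_div_mul_left _ _ hsgn, mul_div_assoc', mul_div_mul_left _ _ hΓ]

lemma integral_Ioc_exp_neg_mul_cos (t : ℝ) {T : ℝ} (hT : 0 ≤ T) :
    ∫ x in Set.Ioc 0 T, exp (-(t * x)) * cos x =
      (t + exp (-(t * T)) * (sin T - t * cos T)) / (1 + t ^ 2) := by
  rw [← intervalIntegral.integral_of_le hT]
  have hd : ∀ x ∈ Set.uIcc 0 T, HasDerivAt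
      (fun y => exp (-(t * y)) * (sin y - t * cos y) / (1 + t ^ 2))
      (exp (-(t * x)) * cos x) x := by
    intro x _
    have h1 : HasDerivAt (fun y => exp (-(t * y))) (exp (-(t * x)) * -(t * 1)) x :=
      (((hasDerivAt_id x).const_mul t).neg).exp
    have h2 := (hasDerivAt_sin x).sub ((hasDerivAt_cos x).const_mul t)
    convert! (h1.mul h2).div_const (1 + t ^ 2) using 1
    have : 1 + t ^ 2 ≠ 0 := by positivity
    field_simp
    simp only [Pi.sub_apply]
    ring
  rw [intervalIntegral.integral_eq_sub_of_hasDerivAt hd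
    (Continuous.intervalIntegrable (by fun_prop) _ _)]
  simp
  ring

lemma abs_integral_Ioc_exp_neg_mul_cos_le {t : ℝ} (ht : 0 ≤ t) {T : ℝ} (hT : 0 ≤ T) :
    |∫ x in Set.Ioc 0 T, exp (-(t * x)) * cos x| ≤ (2 * t + 1) / (1 + t ^ 2) := by
  have hpos : 0 < 1 + t ^ 2 := by positivity
  rw [integral_Ioc_exp_neg_mul_cos t hT, abs_div, abs_of_pos hpos]
  gcongr
  have he : exp (-(t * T)) ≤ 1 := exp_le_one_iff.2 (by simpa using mul_nonneg ht hT)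
  have hsc : |sin T - t * cos T| ≤ 1 + t := by
    calc |sin T - t * cos T| ≤ |sin T| + |t * cos T| := abs_sub _ _
      _ ≤ 1 + t := by
        rw [abs_mul, abs_of_nonneg ht]
        nlinarith [abs_sin_le_one T, abs_cos_le_one T]
  calc |t + exp (-(t * T)) * (sin T - t * cos T)|
      ≤ |t| + |exp (-(t * T)) * (sin T - t * cos T)| := abs_add_le _ _
    _ ≤ t + 1 * (1 + t) := by
      rw [abs_mul, abs_exp, abs_of_nonneg ht]
      gcongr
    _ = 2 * t + 1 := by ring

/-- The conditionally convergent Mellin transform of `cos`. -/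
lemma tendsto_integral_rpow_neg_mul_cos {κ : ℝ} (hκ : 0 < κ) (hκ' : κ < 1) :
    Tendsto (fun T : ℝ => ∫ x in Set.Ioc (0 : ℝ) T, x ^ (-κ) * cos x) atTop
      (nhds (π / 2 / (Gamma κ * cos (π * κ / 2)))) := by
  have hΓ : Gamma κ ≠ 0 := (Gamma_pos_of_pos hκ).ne'
  obtain ⟨hMi, hMv⟩ := integral_rpow_div_one_add_sq (s := κ) (by linarith) hκ'
  have hMi' := (integral_rpow_div_one_add_sq (s := κ - 1) (by linarith) (by linarith)).1
  have hpow : ∀ t ∈ Set.Ioi (0 : ℝ), t ^ (κ - 1) * t = t ^ κ := fun t ht => by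
    rw [rpow_sub_one (ne_of_gt ht), div_mul_cancel₀ _ (ne_of_gt ht)]
  have hfubini : ∀ T : ℝ, 0 ≤ T →
      ∫ x in Set.Ioc (0 : ℝ) T, x ^ (-κ) * cos x =
        (Gamma κ)⁻¹ * ∫ t in Set.Ioi (0 : ℝ),
          t ^ (κ - 1) * ∫ x in Set.Ioc 0 T, exp (-(t * x)) * cos x := by
    intro T hT
    have hx : ∀ x ∈ Set.Ioc (0 : ℝ) T,
        ∫ t in Set.Ioi (0 : ℝ), t ^ (κ - 1) * exp (-(t * x)) * cos x =
          Gamma κ * (x ^ (-κ) * cos x) := by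
      intro x hx
      rw [integral_mul_const, integral_Ioi_rpow_mul_exp_neg_mul hκ hx.1, mul_assoc]
    have hrpow : IntegrableOn (fun x : ℝ => x ^ (-κ)) (Set.Ioc 0 T) :=
      (intervalIntegrable_iff_integrableOn_Ioc_of_le hT).1
        (intervalIntegral.intervalIntegrable_rpow' (by linarith))
    have hprod : Integrable (Function.uncurry fun x t : ℝ => t ^ (κ - 1) * exp (-(t * x)) * cos x)
        ((volume.restrict (Set.Ioc 0 T)).prod (volume.restrict (Set.Ioi 0))) := by
      rw [integrable_prod_iff (by
        apply Measurable.aestronglyMeasurable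
        unfold Function.uncurry
        fun_prop)]
      constructor
      · filter_upwards [ae_restrict_mem measurableSet_Ioc] with x hx'
        exact (integrableOn_rpow_mul_exp_neg_mul hκ hx'.1).mul_const (cos x)
      · have hdom := (hrpow.mul_bdd (c := 1) continuous_cos.abs.aestronglyMeasurable
          (ae_of_all _ fun x => by simpa using abs_cos_le_one x)).const_mul (Gamma κ)
        refine hdom.congr ?_
        filter_upwards [ae_restrict_mem measurableSet_Ioc] with x hx'
        rw [← mul_assoc, ← integral_Ioi_rpow_mul_exp_neg_mul hκ hx'.1, ← integral_mul_const]
        refine setIntegral_congr_fun measurableSet_Ioi fun t ht => ?_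
        have h0 : (0 : ℝ) ≤ t ^ (κ - 1) := rpow_nonneg (le_of_lt ht) _
        simp [Function.uncurry, abs_of_nonneg h0]
    have hswap := integral_integral_swap hprod
    rw [setIntegral_congr_fun measurableSet_Ioc hx, integral_const_mul] at hswap
    simp only [mul_assoc, integral_const_mul] at hswap
    rw [← hswap, inv_mul_cancel_left₀ hΓ]
  have hlim : Tendsto (fun T : ℝ => ∫ t in Set.Ioi (0 : ℝ),
      t ^ (κ - 1) * ∫ x in Set.Ioc 0 T, exp (-(t * x)) * cos x) atTop
      (nhds (∫ t in Set.Ioi (0 : ℝ), t ^ κ / (1 + t ^ 2))) := by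
    refine tendsto_integral_filter_of_dominated_convergence
      (fun t => 2 * (t ^ κ / (1 + t ^ 2)) + t ^ (κ - 1) / (1 + t ^ 2)) ?_ ?_
      ((hMi.const_mul 2).add hMi') ?_
    · filter_upwards [eventually_ge_atTop 0] with T hT
      simp only [integral_Ioc_exp_neg_mul_cos _ hT]
      apply Measurable.aestronglyMeasurable
      fun_prop
    · filter_upwards [eventually_ge_atTop 0] with T hT
      filter_upwards [ae_restrict_mem measurableSet_Ioi] with t ht
      have h0 : (0 : ℝ) ≤ t ^ (κ - 1) := rpow_nonneg (le_of_lt ht) _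
      rw [norm_mul, norm_eq_abs, norm_eq_abs, abs_of_nonneg h0]
      calc _ ≤ t ^ (κ - 1) * ((2 * t + 1) / (1 + t ^ 2)) := by
            gcongr
            exact abs_integral_Ioc_exp_neg_mul_cos_le (le_of_lt ht) hT
        _ = _ := by
            rw [← hpow t ht]
            ring
    · filter_upwards [ae_restrict_mem measurableSet_Ioi] with t ht
      obtain ⟨hi, hv⟩ := integral_exp_neg_mul_cos ht
      have h := (intervalIntegral_tendsto_integral_Ioi 0 hi tendsto_id).const_mul (t ^ (κ - 1))
      rw [hv, ← mul_div_assoc, hpow t ht] at h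
      refine h.congr' ?_
      filter_upwards [eventually_ge_atTop 0] with T hT
      rw [id, intervalIntegral.integral_of_le hT]
  have h := hlim.const_mul (Gamma κ)⁻¹
  rw [hMv, inv_mul_eq_div, div_div, mul_comm (cos _)] at h
  refine h.congr' ?_
  filter_upwards [eventually_ge_atTop 0] with T hT
  exact (hfubini T hT).symm

lemma tendsto_integral_rpow_neg_mul_cosRemainder {κ : ℝ} (hκ : 0 < κ)
    (hodd : ∀ n : ℕ, κ ≠ 2 * n + 1) :
    Tendsto (fun T : ℝ => ∫ x in Set.Ioc (0 : ℝ) T, x ^ (-κ) * cosRemainder ⌈(κ - 1) / 2⌉₊ x)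
      atTop (nhds (π / 2 / (Gamma κ * cos (π * κ / 2)))) := by
  rcases hN : ⌈(κ - 1) / 2⌉₊ with _ | N
  · have hle := Nat.ceil_eq_zero.1 hN
    have hlt : κ < 1 := lt_of_le_of_ne (by linarith) (by simpa using hodd 0)
    simpa [cosRemainder] using tendsto_integral_rpow_neg_mul_cos hκ hlt
  · obtain ⟨h1, h2⟩ := (Nat.ceil_eq_iff (Nat.succ_ne_zero N)).1 hN
    rw [show N + 1 - 1 = N from rfl] at h1
    have hne := hodd (N + 1)
    push_cast at h2 hne
    have hlt : κ < 2 * (N : ℝ) + 3 :=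
      lt_of_le_of_ne (by linarith) (fun h => hne (by linarith))
    obtain ⟨hi, hv⟩ := integral_rpow_neg_mul_cosRemainder_succ N (by linarith) hlt
    rw [← hv]
    refine (intervalIntegral_tendsto_integral_Ioi 0 hi tendsto_id).congr' ?_
    filter_upwards [eventually_ge_atTop 0] with T hT
    rw [id, intervalIntegral.integral_of_le hT]

lemma cosRemainder_abs (N : ℕ) (x : ℝ) : cosRemainder N |x| = cosRemainder N x := by
  simp [cosRemainder, pow_mul]

lemma integral_Ioc_rpow_neg_mul_comp_mul_left (κ : ℝ) (f : ℝ → ℝ) {a : ℝ} (ha : 0 < a) {T : ℝ}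
    (hT : 0 ≤ T) :
    ∫ x in Set.Ioc 0 T, x ^ (-κ) * f (a * x) =
      (∫ x in Set.Ioc 0 (a * T), x ^ (-κ) * f x) * a ^ (κ - 1) := by
  have hscale := intervalIntegral.integral_comp_mul_left (a := 0) (b := T)
    (fun x => x ^ (-κ) * f x) ha.ne'
  rw [mul_zero, intervalIntegral.integral_of_le hT,
    intervalIntegral.integral_of_le (mul_nonneg ha.le hT), smul_eq_mul] at hscale
  have hcongr : ∀ x ∈ Set.Ioc 0 T,
      x ^ (-κ) * f (a * x) = a ^ κ * ((a * x) ^ (-κ) * f (a * x)) := by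
    intro x hx
    rw [mul_rpow ha.le hx.1.le, ← mul_assoc, ← mul_assoc, ← rpow_add ha]
    simp
  rw [setIntegral_congr_fun measurableSet_Ioc hcongr, integral_const_mul, hscale,
    rpow_sub_one ha.ne']
  ring

lemma pi_div_two_div_Gamma_mul_cos {κ : ℝ} (hκ : ∀ n : ℤ, κ ≠ n) :
    π / 2 / (Gamma κ * cos (π * κ / 2)) = Gamma (1 - κ) * sin (π * κ / 2) := by
  have hΓ : Gamma κ ≠ 0 := Gamma_ne_zero fun m => by simpa using hκ (-m)
  have hsin : sin (π * κ) ≠ 0 := by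
    intro h
    obtain ⟨n, hn⟩ := sin_eq_zero_iff.1 h
    exact hκ n (mul_left_cancel₀ pi_ne_zero (by linarith))
  have hdouble : sin (π * κ) = 2 * sin (π * κ / 2) * cos (π * κ / 2) := by
    rw [← sin_two_mul]
    ring_nf
  have hrefl := Gamma_mul_Gamma_one_sub κ
  rw [hdouble] at hsin hrefl
  have hc : cos (π * κ / 2) ≠ 0 := fun h => hsin (by simp [h])
  rw [eq_div_iff hsin] at hrefl
  rw [div_eq_iff (mul_ne_zero hΓ hc)]
  linear_combination -hrefl / 2

theorem stmt5 (κ : ℝ) (hκ : 0 < κ) (hodd : ∀ n : ℕ, κ ≠ 2 * n + 1)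
    (θ : ℝ) (hθ : θ ≠ 0) :
    Tendsto (fun T : ℝ => ∫ x in Set.Ioc (0 : ℝ) T,
        x ^ (-κ) * (Real.cos (θ * x) -
          ∑ j ∈ Finset.range ⌈(κ - 1) / 2⌉₊, (-1 : ℝ) ^ j * (θ * x) ^ (2 * j) /
            (Nat.factorial (2 * j) : ℝ)))
      atTop
      (nhds ((Real.pi / 2) / (Real.Gamma κ * Real.cos (Real.pi * κ / 2)) * |θ| ^ (κ - 1))) ∧
    ((∀ n : ℤ, κ ≠ n) →
      (Real.pi / 2) / (Real.Gamma κ * Real.cos (Real.pi * κ / 2)) =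
        Real.Gamma (1 - κ) * Real.sin (Real.pi * κ / 2)) := by
  refine ⟨?_, pi_div_two_div_Gamma_mul_cos⟩
  have ha : 0 < |θ| := abs_pos.2 hθ
  have hlim := ((tendsto_integral_rpow_neg_mul_cosRemainder hκ hodd).comp
    (tendsto_id.const_mul_atTop ha)).mul_const (|θ| ^ (κ - 1))
  refine hlim.congr' ?_
  filter_upwards [eventually_ge_atTop 0] with T hT
  rw [Function.comp_apply, id, ← integral_Ioc_rpow_neg_mul_comp_mul_left κ _ ha hT]
  refine setIntegral_congr_fun measurableSet_Ioc fun x hx => ?_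
  have habs : cosRemainder ⌈(κ - 1) / 2⌉₊ (|θ| * x) = cosRemainder ⌈(κ - 1) / 2⌉₊ (θ * x) := by
    rw [← cosRemainder_abs _ (θ * x), abs_mul, abs_of_pos hx.1]
  simp only [habs]
  rfl
end
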